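/- Suppose G is connected. Let i ∈ V and let t be an integer with 0 < t < 6n². Then the expected number of visits of the Metropolis–Hastings walk RW(G_1) started at i to i before time t satisfies E_i N_i(t) < 5√t + 2Δ; equivalently, Σ_{τ=0}^{t−1} (P^τ)_{ii} < 5√t + 2Δ. -/

import Mathlib

open Finset

/-- The Metropolis–Hastings transition matrix on a graph, with unit potential:
`P v u = min (1/deg v) (1/deg u)` for adjacent `u ≠ v`, `0` for non-adjacent `u ≠ v`,
and `P v v = 1 - ∑_{u ∈ Γ(v)} min (1/deg v) (1/deg u)`. -/
noncomputable def mhMatrix {V : Type*} [Fintype V] [DecidableEq V] (G : SimpleGraph V)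
    [DecidableRel G.Adj] : Matrix V V ℝ :=
  Matrix.of fun v u =>
    if u = v then
      1 - ∑ w ∈ G.neighborFinset v, min ((G.degree v : ℝ))⁻¹ ((G.degree w : ℝ))⁻¹
    else if G.Adj v u then min ((G.degree v : ℝ))⁻¹ ((G.degree u : ℝ))⁻¹
    else 0

/-- Probability, for the Markov chain with transition matrix `P` and initial distribution `μ`,
that the trajectory `(X_0, …, X_L)` lies in the event `E`. -/
noncomputable def prTraj {V : Type*} [Fintype V] (P : Matrix V V ℝ) (μ : V → ℝ) (L : ℕ)
    (E : Set (Fin (L + 1) → V)) : ℝ :=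
  ∑ x : Fin (L + 1) → V,
    E.indicator (fun y => μ (y 0) * ∏ τ : Fin L, P (y τ.castSucc) (y τ.succ)) x

/-- Point mass at `i`, as an initial distribution. -/
def dirac {V : Type*} [DecidableEq V] (i : V) : V → ℝ := fun v => if v = i then 1 else 0

section helpers
variable {V : Type*} [Fintype V] [DecidableEq V]

lemma mh_symm (G : SimpleGraph V) [DecidableRel G.Adj] (u v : V) :
    mhMatrix G u v = mhMatrix G v u := by
  by_cases h : u = v
  · rw [h]
  · simp only [mhMatrix, Matrix.of_apply, if_neg h, if_neg (Ne.symm h), G.adj_comm u v]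
    rw [min_comm]

lemma mh_adj (G : SimpleGraph V) [DecidableRel G.Adj] {u v : V} (h : G.Adj u v) :
    mhMatrix G u v = min ((G.degree u : ℝ))⁻¹ ((G.degree v : ℝ))⁻¹ := by
  simp [mhMatrix, h.ne', h]

lemma mh_nonneg (G : SimpleGraph V) [DecidableRel G.Adj] (u v : V) :
    0 ≤ mhMatrix G u v := by
  simp only [mhMatrix, Matrix.of_apply]
  split_ifs with h1 h2
  · have : ∑ w ∈ G.neighborFinset u, min ((G.degree u : ℝ))⁻¹ ((G.degree w : ℝ))⁻¹
        ≤ ∑ w ∈ G.neighborFinset u, ((G.degree u : ℝ))⁻¹ :=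
      Finset.sum_le_sum fun w _ => min_le_left _ _
    rw [Finset.sum_const, G.card_neighborFinset_eq_degree, nsmul_eq_mul] at this
    have h3 := mul_inv_le_one (a := (G.degree u : ℝ))
    linarith
  · positivity
  · exact le_rfl

lemma mh_row (G : SimpleGraph V) [DecidableRel G.Adj] (v : V) :
    ∑ u, mhMatrix G v u = 1 := by
  rw [← Finset.add_sum_erase _ _ (Finset.mem_univ v)]
  have : ∑ u ∈ Finset.univ.erase v, mhMatrix G v u =
      ∑ w ∈ G.neighborFinset v, min ((G.degree v : ℝ))⁻¹ ((G.degree w : ℝ))⁻¹ := by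
    rw [← Finset.sum_subset (s₁ := G.neighborFinset v) (s₂ := Finset.univ.erase v)]
    · refine Finset.sum_congr rfl fun w hw => ?_
      rw [mh_adj G ((G.mem_neighborFinset v w).1 hw)]
    · intro w hw
      simpa using ((G.mem_neighborFinset v w).1 hw).ne'
    · intro w hw hw'
      have h1 : w ≠ v := by simpa using hw
      have h2 : ¬ G.Adj v w := by simpa using hw'
      simp [mhMatrix, h1, h2]
  rw [this]
  simp [mhMatrix]

lemma pow_nonneg_entry (P : Matrix V V ℝ) (hP : ∀ u v, 0 ≤ P u v) (n : ℕ) (u v : V) :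
    0 ≤ (P ^ n) u v := by
  induction n generalizing v with
  | zero => simp only [pow_zero, Matrix.one_apply]; split_ifs <;> norm_num
  | succ n ih =>
    rw [pow_succ, Matrix.mul_apply]
    exact Finset.sum_nonneg fun w _ => mul_nonneg (ih w) (hP w v)

lemma pow_row (P : Matrix V V ℝ) (hP : ∀ u, ∑ v, P u v = 1) (n : ℕ) (u : V) :
    ∑ v, (P ^ n) u v = 1 := by
  induction n with
  | zero => simp [Matrix.one_apply]
  | succ n ih =>
    simp only [pow_succ, Matrix.mul_apply]
    rw [Finset.sum_comm]
    simp only [← Finset.mul_sum, hP, mul_one, ih]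

lemma energy_id (P : Matrix V V ℝ) (hs : ∀ u v, P u v = P v u) (hr : ∀ u, ∑ v, P u v = 1)
    (f h : V → ℝ) :
    ∑ u, ∑ v, P u v * ((h u - h v) * (f u - f v)) =
      2 * ∑ u, h u * (f u - ∑ v, P u v * f v) := by
  have e1 : ∑ u, ∑ v, P u v * (h u * (f u - f v)) =
      ∑ u, h u * (f u - ∑ v, P u v * f v) := by
    refine Finset.sum_congr rfl fun u _ => ?_
    have : h u * (f u - ∑ v, P u v * f v) =
      h u * ((∑ v, P u v) * f u - ∑ v, P u v * f v) := by rw [hr, one_mul]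
    rw [this, Finset.sum_mul, ← Finset.sum_sub_distrib, Finset.mul_sum]
    exact Finset.sum_congr rfl fun v _ => by ring
  have e2 : ∑ u, ∑ v, P u v * (h v * (f v - f u)) =
      ∑ u, ∑ v, P u v * (h u * (f u - f v)) := by
    rw [Finset.sum_comm]
    refine Finset.sum_congr rfl fun u _ => Finset.sum_congr rfl fun v _ => ?_
    rw [hs]
  have e3 : ∑ u, ∑ v, P u v * ((h u - h v) * (f u - f v)) =
      ∑ u, ∑ v, P u v * (h u * (f u - f v)) + ∑ u, ∑ v, P u v * (h v * (f v - f u)) := by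
    simp only [← Finset.sum_add_distrib]
    exact Finset.sum_congr rfl fun u _ => Finset.sum_congr rfl fun v _ => by ring
  rw [e3, e2, e1, two_mul]

lemma energy_bound (P : Matrix V V ℝ) (h0 : ∀ u v, 0 ≤ P u v)
    (hs : ∀ u v, P u v = P v u) (hr : ∀ u, ∑ v, P u v = 1) (i : V) (t : ℕ) (a : ℝ)
    (f h : V → ℝ) (hf : f = fun v => ∑ τ ∈ Finset.range t, (P ^ τ) i v)
    (hh : h = fun v => max (f v - a) 0) :
    ∑ u, ∑ v, P u v * (h u - h v) ^ 2 ≤ 2 * h i := by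
  have hnn : ∀ u, 0 ≤ h u := fun u => by rw [hh]; exact le_max_right _ _
  have key : ∀ u, f u - ∑ v, P u v * f v = (1 : Matrix V V ℝ) i u - (P ^ t) i u := by
    intro u
    have : ∑ v, P u v * f v = ∑ τ ∈ Finset.range t, (P ^ (τ + 1)) i u := by
      simp only [hf, Finset.mul_sum]
      rw [Finset.sum_comm]
      refine Finset.sum_congr rfl fun τ _ => ?_
      rw [pow_succ, Matrix.mul_apply]
      refine Finset.sum_congr rfl fun v _ => ?_
      rw [hs, mul_comm]
    rw [this, hf]
    have h1 := Finset.sum_range_succ (fun τ => (P ^ τ) i u) t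
    have h2 := Finset.sum_range_succ' (fun τ => (P ^ τ) i u) t
    simp only [pow_zero] at h2
    simp only
    linarith
  calc ∑ u, ∑ v, P u v * (h u - h v) ^ 2
      ≤ ∑ u, ∑ v, P u v * ((h u - h v) * (f u - f v)) := by
        refine Finset.sum_le_sum fun u _ => Finset.sum_le_sum fun v _ => ?_
        refine mul_le_mul_of_nonneg_left ?_ (h0 u v)
        simp only [hh]
        rcases le_total (f u - a) 0 with h1 | h1 <;> rcases le_total (f v - a) 0 with h2 | h2 <;>
          simp only [h1, h2, max_eq_left, max_eq_right] <;> nlinarith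
    _ = 2 * ∑ u, h u * (f u - ∑ v, P u v * f v) := energy_id P hs hr f h
    _ ≤ 2 * ∑ u, h u * (1 : Matrix V V ℝ) i u := by
        gcongr with u _
        · exact hnn u
        · rw [key]
          linarith [pow_nonneg_entry P h0 t i u]
    _ = 2 * h i := by simp [Matrix.one_apply]

lemma exists_geodesic (G : SimpleGraph V) (hG : G.Connected) (i x : V) :
    ∃ p : ℕ → V, p 0 = i ∧ p (G.dist i x) = x ∧
      (∀ j < G.dist i x, G.Adj (p j) (p (j + 1))) ∧ ∀ j ≤ G.dist i x, G.dist i (p j) = j := by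
  obtain ⟨w, hw⟩ := hG.exists_walk_length_eq_dist i x
  refine ⟨w.getVert, w.getVert_zero, hw ▸ w.getVert_length, fun j hj =>
    w.adj_getVert_succ (hw ▸ hj), fun j hj => ?_⟩
  have h1 := SimpleGraph.dist_le (w.take j)
  have h2 := SimpleGraph.dist_le (w.drop j)
  have h3 := hG.dist_triangle (u := i) (v := w.getVert j) (w := x)
  rw [SimpleGraph.Walk.take_length] at h1
  rw [SimpleGraph.Walk.drop_length] at h2
  omega

lemma path_energy (F : V → V → ℝ) (h0 : ∀ u v, 0 ≤ F u v) (hs : ∀ u v, F u v = F v u)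
    (D : V → ℕ) (p : ℕ → V) (k : ℕ) (hD : ∀ j ≤ k, D (p j) = j) :
    2 * ∑ j ∈ Finset.range k, F (p j) (p (j + 1)) ≤ ∑ u, ∑ v, F u v := by
  rw [← Fintype.sum_prod_type' F, two_mul]
  nth_rewrite 2 [Finset.sum_congr rfl fun j _ => hs (p j) (p (j + 1))]
  have i1 : Set.InjOn (fun j => (p j, p (j + 1))) (Finset.range k : Set ℕ) := by
    intro a ha b hb hab
    simp only [Finset.coe_range, Set.mem_Iio, Prod.mk.injEq] at ha hb hab
    rw [← hD a ha.le, ← hD b hb.le, hab.1]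
  have i2 : Set.InjOn (fun j => (p (j + 1), p j)) (Finset.range k : Set ℕ) := by
    intro a ha b hb hab
    simp only [Finset.coe_range, Set.mem_Iio, Prod.mk.injEq] at ha hb hab
    rw [← hD a ha.le, ← hD b hb.le, hab.2]
  rw [← Finset.sum_image (f := fun q : V × V => F q.1 q.2) i1,
    ← Finset.sum_image (f := fun q : V × V => F q.1 q.2) i2, ← Finset.sum_union]
  · exact Finset.sum_le_sum_of_subset_of_nonneg (Finset.subset_univ _) fun q _ _ => h0 _ _
  · rw [Finset.disjoint_left]
    intro q hq hq'
    obtain ⟨a, ha, rfl⟩ := Finset.mem_image.1 hq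
    obtain ⟨b, hb, hab⟩ := Finset.mem_image.1 hq'
    rw [Finset.mem_range] at ha hb
    simp only [Prod.mk.injEq] at hab
    have e1 := congrArg D hab.1
    have e2 := congrArg D hab.2
    rw [hD _ (by omega), hD _ (by omega)] at e1 e2
    omega

lemma degree_sum (G : SimpleGraph V) [DecidableRel G.Adj] (hG : G.Connected) (i : V)
    (p : ℕ → V) (m : ℕ) (hD : ∀ j < m, G.dist i (p j) = j) (B : Finset V)
    (hB : ∀ j < m, ∀ u, G.Adj (p j) u → u ∈ B) :
    ∑ j ∈ Finset.range m, G.degree (p j) ≤ 3 * B.card := by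
  have h1 : ∀ j ∈ Finset.range m, G.degree (p j) = ∑ u ∈ B, if G.Adj (p j) u then 1 else 0 := by
    intro j hj
    rw [← Finset.card_filter, ← G.card_neighborFinset_eq_degree]
    congr 1
    ext u
    simp only [SimpleGraph.mem_neighborFinset, Finset.mem_filter]
    exact ⟨fun h => ⟨hB j (Finset.mem_range.1 hj) u h, h⟩, fun h => h.2⟩
  rw [Finset.sum_congr rfl h1, Finset.sum_comm, mul_comm, ← smul_eq_mul]
  refine Finset.sum_le_card_nsmul _ _ _ fun u _ => ?_
  rw [← Finset.card_filter]
  refine (Finset.card_le_card (t := {G.dist i u - 1, G.dist i u, G.dist i u + 1}) ?_).trans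
    Finset.card_le_three
  intro j hj
  simp only [Finset.mem_filter, Finset.mem_range] at hj
  have hd := hD j hj.1
  have e := SimpleGraph.dist_eq_one_iff_adj.2 hj.2
  have e' := SimpleGraph.dist_eq_one_iff_adj.2 hj.2.symm
  have t1 := hG.dist_triangle (u := i) (v := p j) (w := u)
  have t2 := hG.dist_triangle (u := i) (v := u) (w := p j)
  simp only [Finset.mem_insert, Finset.mem_singleton]
  omega

end helpers

/-- For a connected graph `G`, a vertex `i` and `0 < t < 6n²`, the expected number of
visits of the Metropolis–Hastings walk started at `i` to `i` before time `t`, namely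
`∑_{τ<t} (P^τ)_{ii}`, is less than `5√t + 2Δ`. -/
theorem mh_return_rate {V : Type*} [Fintype V] [DecidableEq V] (G : SimpleGraph V)
    [DecidableRel G.Adj] (hG : G.Connected) (i : V) (t : ℕ)
    (ht0 : 0 < t) (ht : t < 6 * Fintype.card V ^ 2) :
    ∑ τ ∈ Finset.range t, (mhMatrix G ^ τ) i i <
      5 * Real.sqrt t + 2 * (G.maxDegree : ℝ) := by
  obtain ⟨P, hPdef⟩ : ∃ P, P = mhMatrix G := ⟨_, rfl⟩
  have h0 : ∀ u v, 0 ≤ P u v := hPdef ▸ mh_nonneg G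
  have hs : ∀ u v, P u v = P v u := hPdef ▸ mh_symm G
  have hr : ∀ u, ∑ v, P u v = 1 := hPdef ▸ mh_row G
  rw [← hPdef]
  obtain ⟨f, hf⟩ : ∃ f : V → ℝ, f = fun v => ∑ τ ∈ Finset.range t, (P ^ τ) i v := ⟨_, rfl⟩
  have hfi : ∑ τ ∈ Finset.range t, (P ^ τ) i i = f i := by rw [hf]
  rw [hfi]
  have htR : (0 : ℝ) < t := by exact_mod_cast ht0
  have hfnn : ∀ v, 0 ≤ f v := fun v => by
    rw [hf]; exact Finset.sum_nonneg fun τ _ => pow_nonneg_entry P h0 τ i v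
  have hfsum : ∑ v, f v = t := by
    rw [hf, Finset.sum_comm]
    simp [pow_row P hr]
  obtain ⟨a, ha⟩ : ∃ a : ℝ, a = Real.sqrt (6 * t) := ⟨_, rfl⟩
  have hapos : 0 < a := by rw [ha]; positivity
  have ha2 : a ^ 2 = 6 * t := by rw [ha]; exact Real.sq_sqrt (by positivity)
  have hst : 0 < Real.sqrt t := by positivity
  have hst2 : Real.sqrt t ^ 2 = t := Real.sq_sqrt htR.le
  have ha5 : 2 * a < 5 * Real.sqrt t := by nlinarith
  have hΔ : (0 : ℝ) ≤ G.maxDegree := by positivity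
  obtain ⟨B, hBdef⟩ : ∃ B : Finset V, B = Finset.univ.filter fun v => a < f v := ⟨_, rfl⟩
  have hBmem : ∀ v, v ∈ B ↔ a < f v := by intro v; simp [hBdef]
  have hBcard : (B.card : ℝ) * a ≤ t := by
    rw [← hfsum, ← nsmul_eq_mul]
    refine (Finset.card_nsmul_le_sum B f a fun v hv => ((hBmem v).1 hv).le).trans ?_
    exact Finset.sum_le_sum_of_subset_of_nonneg (Finset.subset_univ _) fun v _ _ => hfnn v
  have hB6 : 6 * (B.card : ℝ) ≤ a := by nlinarith
  -- the complement of B is nonempty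
  have hne : (Finset.univ.filter fun v => v ∉ B).Nonempty := by
    by_contra hcon
    rw [Finset.not_nonempty_iff_eq_empty, Finset.filter_eq_empty_iff] at hcon
    have : B = Finset.univ := by
      ext v
      have := hcon (Finset.mem_univ v)
      simpa using this
    rw [this, Finset.card_univ] at hB6
    have ht' : (t : ℝ) < 6 * (Fintype.card V : ℝ) ^ 2 := by exact_mod_cast ht
    have hn : (0 : ℝ) ≤ Fintype.card V := by positivity
    nlinarith
  obtain ⟨x, hx, hxmin⟩ := Finset.exists_min_image _ (fun v => G.dist i v) hne
  have hxB : x ∉ B := by simpa using hx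
  have hfx : f x ≤ a := by
    by_contra hc
    exact hxB ((hBmem x).2 (not_le.1 hc))
  have hclose : ∀ v, G.dist i v < G.dist i x → v ∈ B := by
    intro v hv
    by_contra hc
    have := hxmin v (by simpa using hc)
    omega
  obtain ⟨p, hp0, hpk, hadj, hdist⟩ := exists_geodesic G hG i x
  obtain ⟨k, hk⟩ : ∃ k, k = G.dist i x := ⟨_, rfl⟩
  rw [← hk] at hpk hadj hdist hclose
  obtain ⟨h, hh⟩ : ∃ h : V → ℝ, h = fun v => max (f v - a) 0 := ⟨_, rfl⟩
  have hEn := energy_bound P h0 hs hr i t a f h hf hh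
  have hpath := path_energy (fun u v => P u v * (h u - h v) ^ 2)
    (fun u v => mul_nonneg (h0 u v) (sq_nonneg _))
    (fun u v => by rw [hs u v]; ring) (G.dist i) p k hdist
  have hEp : ∑ j ∈ Finset.range k, P (p j) (p (j + 1)) * (h (p j) - h (p (j + 1))) ^ 2 ≤ h i := by
    have := hpath.trans hEn
    linarith
  obtain ⟨r, hrdef⟩ : ∃ r : ℕ → ℝ, r = fun j => max (G.degree (p j) : ℝ) (G.degree (p (j + 1))) :=
    ⟨_, rfl⟩
  have hrΔ : ∀ j, r j ≤ G.maxDegree := by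
    intro j
    rw [hrdef]
    exact max_le (by exact_mod_cast G.degree_le_maxDegree _)
      (by exact_mod_cast G.degree_le_maxDegree _)
  have hrnn : ∀ j, 0 ≤ r j := by
    intro j
    rw [hrdef]
    positivity
  have hrP : ∀ j < k, r j * P (p j) (p (j + 1)) = 1 := by
    intro j hj
    have hA := hadj j hj
    have d1 : (0 : ℝ) < G.degree (p j) := by
      exact_mod_cast (G.degree_pos_iff_exists_adj _).2 ⟨_, hA⟩
    have d2 : (0 : ℝ) < G.degree (p (j + 1)) := by
      exact_mod_cast (G.degree_pos_iff_exists_adj _).2 ⟨_, hA.symm⟩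
    rw [hPdef, mh_adj G hA, hrdef]
    simp only
    rcases le_total (G.degree (p j) : ℝ) (G.degree (p (j + 1))) with hle | hle
    · rw [max_eq_right hle, min_eq_right (inv_anti₀ d1 hle), mul_inv_cancel₀ d2.ne']
    · rw [max_eq_left hle, min_eq_left (inv_anti₀ d2 hle), mul_inv_cancel₀ d1.ne']
  have hCS : h i ^ 2 ≤ (∑ j ∈ Finset.range k, r j) * h i := by
    have tel : ∑ j ∈ Finset.range k, (h (p j) - h (p (j + 1))) = h i := by
      rw [Finset.sum_range_sub' (fun j => h (p j)), hp0, hpk]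
      have : h x = 0 := by rw [hh]; exact max_eq_right (by linarith)
      rw [this, sub_zero]
    have cs := Finset.sum_sq_le_sum_mul_sum_of_sq_le_mul (Finset.range k)
      (r := fun j => h (p j) - h (p (j + 1))) (f := r)
      (g := fun j => P (p j) (p (j + 1)) * (h (p j) - h (p (j + 1))) ^ 2)
      (fun j _ => hrnn j) (fun j _ => mul_nonneg (h0 _ _) (sq_nonneg _))
      (fun j hj => by
        rw [← mul_assoc, hrP j (Finset.mem_range.1 hj), one_mul])
    rw [tel] at cs
    exact cs.trans (mul_le_mul_of_nonneg_left hEp (Finset.sum_nonneg fun j _ => hrnn j))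
  have hRnn : 0 ≤ ∑ j ∈ Finset.range k, r j := Finset.sum_nonneg fun j _ => hrnn j
  have hhR : h i ≤ ∑ j ∈ Finset.range k, r j := by
    by_contra hc
    push Not at hc
    nlinarith
  have hR : ∑ j ∈ Finset.range k, r j ≤ 6 * (B.card : ℝ) + 2 * G.maxDegree := by
    rcases k with _ | _ | m
    · rw [Finset.range_zero, Finset.sum_empty]
      have : (0 : ℝ) ≤ B.card := Nat.cast_nonneg _
      linarith
    · simp only [zero_add, Finset.sum_range_one]
      have := hrΔ 0
      have : (0 : ℝ) ≤ B.card := Nat.cast_nonneg _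
      linarith
    · rw [Finset.sum_range_succ, Finset.sum_range_succ]
      have hdeg : ∑ j ∈ Finset.range (m + 1), (G.degree (p j) : ℝ) ≤ 3 * B.card := by
        have := degree_sum G hG i p (m + 1) (fun j hj => hdist j (by omega)) B (by
          intro j hj u hu
          apply hclose
          have e := SimpleGraph.dist_eq_one_iff_adj.2 hu
          have t1 := hG.dist_triangle (u := i) (v := p j) (w := u)
          have := hdist j (by omega)
          omega)
        exact_mod_cast this
      have s1 := Finset.sum_range_succ (fun j => (G.degree (p j) : ℝ)) m
      have s2 := Finset.sum_range_succ' (fun j => (G.degree (p j) : ℝ)) m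
      have n1 : (0 : ℝ) ≤ G.degree (p m) := by positivity
      have n2 : (0 : ℝ) ≤ G.degree (p 0) := by positivity
      have : ∑ j ∈ Finset.range m, r j ≤ ∑ j ∈ Finset.range m,
          ((G.degree (p j) : ℝ) + G.degree (p (j + 1))) := by
        refine Finset.sum_le_sum fun j _ => ?_
        rw [hrdef]
        exact max_le_add_of_nonneg (by positivity) (by positivity)
      rw [Finset.sum_add_distrib] at this
      have := hrΔ m
      have := hrΔ (m + 1)
      linarith
  have hfin : f i - a ≤ h i := by rw [hh]; exact le_max_left _ _
  linarith
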